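/- Let M_B be the 2 × 2 integer matrix ((1, 1), (1, −1)) and n ≥ 2. Then lcmd(M_B ⊗ D(K_n)) = 2^{n−1}, where lcmd denotes the lcm of the absolute values of all nonzero subdeterminants. -/

import Mathlib

open Matrix Kronecker

/-- Edges of the complete graph `K_n`. -/
def CompEdge (n : ℕ) := {e : Fin n × Fin n // e.1 < e.2}

instance (n : ℕ) : Fintype (CompEdge n) := by unfold CompEdge; infer_instance
instance (n : ℕ) : DecidableEq (CompEdge n) := by unfold CompEdge; infer_instance

/-- Incidence matrix of the complete graph `K_n`. -/
def incK (n : ℕ) : Matrix (Fin n) (CompEdge n) ℤ :=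
  fun v e => if v = e.1.1 then 1 else if v = e.1.2 then -1 else 0

/-- lcmd: lcm of the absolute values of all nonzero subdeterminants. -/
def lcmd {α β : Type*} [Fintype α] [DecidableEq α] [Fintype β] [DecidableEq β]
    (M : Matrix α β ℤ) : ℕ :=
  (((Finset.univ : Finset (Σ k : Fin (Fintype.card α + 1), (Fin k.1 → α) × (Fin k.1 → β))).image
    (fun x => ((M.submatrix x.2.1 x.2.2).det).natAbs)).erase 0).lcm id

/-- The Schur complement formula for a pivot of absolute value `1`. -/
theorem det_eq_unit_mul_det_schur {k : ℕ} (A : Matrix (Fin (k + 1)) (Fin (k + 1)) ℤ)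
    (r c : Fin (k + 1)) (h : A r c * A r c = 1) :
    ∃ u : ℤ, u * u = 1 ∧ A.det = u * (Matrix.of fun i j =>
      A (r.succAbove i) (c.succAbove j)
        - A (r.succAbove i) c * A r c * A r (c.succAbove j)).det := by
  have hB : A.det = (Matrix.of fun i j =>
      A i j - (if i = r then 0 else A i c * A r c) * A r j).det := by
    refine Matrix.det_eq_of_forall_row_eq_smul_add_const
      (fun i => if i = r then 0 else A i c * A r c) r (by simp) fun i j => ?_
    simp
  refine ⟨(-1) ^ (r + c : ℕ) * A r c, ?_, ?_⟩
  · rw [mul_mul_mul_comm, h, mul_one, ← mul_pow]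
    norm_num
  · rw [hB, Matrix.det_succ_column _ c, Finset.sum_eq_single r]
    · congr 1
      · simp
      · congr 1
        ext i j
        simp [Fin.succAbove_ne]
    · intro i _ hi
      have : A i c - A i c * A r c * A r c = 0 := by
        rw [mul_assoc, h, mul_one, sub_self]
      simp [hi, this]
    · simp

/-- A square integer matrix whose columns have `ℓ¹`-norm at most `2` has determinant zero or, up to
sign, a power of two. -/
theorem exists_natAbs_det_eq_two_pow {k : ℕ} (A : Matrix (Fin k) (Fin k) ℤ)
    (hA : ∀ c, ∑ i, |A i c| ≤ 2) (hd : A.det ≠ 0) : ∃ j, A.det.natAbs = 2 ^ j := by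
  induction k with
  | zero => exact ⟨0, by simp⟩
  | succ k ih =>
    obtain ⟨r, hr⟩ : ∃ r, A r 0 ≠ 0 := by
      by_contra! h
      exact hd (Matrix.det_eq_zero_of_column_eq_zero 0 h)
    have hpos := abs_pos.2 hr
    have hsum := hA 0
    rw [Fin.sum_univ_succAbove _ r] at hsum
    have hnn : 0 ≤ ∑ i, |A (r.succAbove i) 0| := Finset.sum_nonneg fun _ _ => abs_nonneg _
    rcases (by omega : |A r 0| = 1 ∨ |A r 0| = 2) with h1 | h2
    · have hsq : A r 0 * A r 0 = 1 := by rw [← abs_mul_abs_self, h1, one_mul]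
      obtain ⟨u, hu, hdet⟩ := det_eq_unit_mul_det_schur A r 0 hsq
      rw [hdet] at hd ⊢
      have hu' : u.natAbs = 1 := by
        have := congrArg Int.natAbs hu
        rw [Int.natAbs_mul] at this
        exact Nat.eq_one_of_mul_eq_one_right this
      rw [Int.natAbs_mul, hu', one_mul]
      refine ih _ (fun c => ?_) (right_ne_zero_of_mul hd)
      have hc := hA (Fin.succAbove 0 c)
      rw [Fin.sum_univ_succAbove _ r] at hc
      calc _ ≤ ∑ i, (|A (r.succAbove i) (Fin.succAbove 0 c)|
              + |A (r.succAbove i) 0| * |A r (Fin.succAbove 0 c)|) := by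
            refine Finset.sum_le_sum fun i _ => (abs_sub _ _).trans ?_
            rw [abs_mul, abs_mul, h1, mul_one]
        _ ≤ 2 := by
            rw [Finset.sum_add_distrib, ← Finset.sum_mul]
            nlinarith [abs_nonneg (A r (Fin.succAbove 0 c))]
    · have hz : ∀ i, A (r.succAbove i) 0 = 0 := by
        have h0 : ∑ i, |A (r.succAbove i) 0| = 0 := by omega
        intro i
        exact abs_eq_zero.1
          ((Finset.sum_eq_zero_iff_of_nonneg fun _ _ => abs_nonneg _).1 h0 i (Finset.mem_univ i))
      have hdet : A.det = (-1) ^ (r + (0 : Fin (k + 1)) : ℕ) * A r 0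
          * (A.submatrix r.succAbove (Fin.succAbove 0)).det := by
        rw [Matrix.det_succ_column _ 0, Fin.sum_univ_succAbove _ r]
        simp [hz]
      rw [hdet] at hd ⊢
      have h2' : (A r 0).natAbs = 2 := by rw [Int.abs_eq_natAbs] at h2; exact_mod_cast h2
      obtain ⟨j, hj⟩ := ih (A.submatrix r.succAbove (Fin.succAbove 0)) (fun c => by
        have hc := hA (Fin.succAbove 0 c)
        rw [Fin.sum_univ_succAbove _ r] at hc
        have := abs_nonneg (A r (Fin.succAbove 0 c))
        simp only [Matrix.submatrix_apply]
        linarith) (right_ne_zero_of_mul hd)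
      refine ⟨j + 1, ?_⟩
      rw [Int.natAbs_mul, Int.natAbs_mul, Int.natAbs_pow, hj, h2']
      simp [pow_succ, mul_comm]

/-- Hadamard's inequality for real matrices. -/
theorem abs_det_le_prod_norm_col {k : ℕ} (A : Matrix (Fin k) (Fin k) ℝ) :
    |A.det| ≤ ∏ c, ‖WithLp.toLp 2 (A.col c)‖ := by
  let b := EuclideanSpace.basisFun (Fin k) ℝ
  have : Fact (Module.finrank ℝ (EuclideanSpace ℝ (Fin k)) = k) := ⟨by simp⟩
  have h := b.toBasis.orientation.abs_volumeForm_apply_le fun c => WithLp.toLp 2 (A.col c)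
  rw [b.toBasis.orientation.volumeForm_robust' b, Module.Basis.det_apply] at h
  exact h

theorem det_sq_le_two_pow_of_sum_sq_le {k : ℕ} (A : Matrix (Fin k) (Fin k) ℤ)
    (hA : ∀ c, ∑ i, A i c ^ 2 ≤ 2) : A.det ^ 2 ≤ 2 ^ k := by
  have h := abs_det_le_prod_norm_col (A.map (Int.cast : ℤ → ℝ))
  have hdet : (A.map (Int.cast : ℤ → ℝ)).det = (A.det : ℝ) :=
    ((Int.castRingHom ℝ).map_det A).symm
  have h2 : ((A.det : ℝ)) ^ 2 ≤ 2 ^ k := by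
    rw [← hdet, ← sq_abs]
    calc _ ≤ (∏ c, ‖WithLp.toLp 2 ((A.map (Int.cast : ℤ → ℝ)).col c)‖) ^ 2 :=
          pow_le_pow_left₀ (abs_nonneg _) h 2
      _ = ∏ c, ‖WithLp.toLp 2 ((A.map (Int.cast : ℤ → ℝ)).col c)‖ ^ 2 :=
          (Finset.prod_pow _ _ _).symm
      _ ≤ ∏ _c : Fin k, (2 : ℝ) := by
          refine Finset.prod_le_prod (fun _ _ => sq_nonneg _) fun c _ => ?_
          rw [EuclideanSpace.norm_sq_eq]
          simp only [Matrix.col_apply, Matrix.map_apply, Real.norm_eq_abs, sq_abs]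
          exact_mod_cast hA c
      _ = 2 ^ k := by simp
  exact_mod_cast h2

theorem sum_abs_le_two_of_abs_subset_sum_le_one {ι : Type*} [Fintype ι] (x : ι → ℤ)
    (hx : ∀ S : Finset ι, |∑ i ∈ S, x i| ≤ 1) : ∑ i, |x i| ≤ 2 := by
  classical
  rw [← Finset.sum_filter_add_sum_filter_not Finset.univ (fun i => 0 ≤ x i)]
  have h1 := hx {i | 0 ≤ x i}
  have h2 := hx {i | ¬ 0 ≤ x i}
  have e1 : ∑ i with 0 ≤ x i, |x i| = ∑ i with 0 ≤ x i, x i :=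
    Finset.sum_congr rfl fun i hi => abs_of_nonneg (by simpa using hi)
  have e2 : ∑ i with ¬ 0 ≤ x i, |x i| = -∑ i with ¬ 0 ≤ x i, x i := by
    rw [← Finset.sum_neg_distrib]
    exact Finset.sum_congr rfl fun i hi =>
      abs_of_nonpos (by simp only [Finset.mem_filter_univ] at hi; omega)
  rw [e1, e2]
  rw [abs_le] at h1 h2
  omega

theorem abs_eq_one_of_mul_self_eq_one {x : ℤ} (h : x * x = 1) : |x| = 1 := by
  rcases mul_self_eq_one_iff.1 h with rfl | rfl <;> rfl

/-- Let the columns of `A` be coloured by `t`, let `ρ` colour some of the rows, and suppose that a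
coloured row vanishes on all columns of other colours. If, after a change of row signs depending
only on the colour of the column, all subset sums in each column are at most `1` in absolute value,
then `det A ^ 2` is at most `2` to the number of uncoloured rows. -/
theorem det_sq_le_two_pow_card_none {β : Type*} {k : ℕ} (A : Matrix (Fin k) (Fin k) ℤ)
    (ρ : Fin k → Option β) (t : Fin k → β) (σ : β → Fin k → ℤ) (hσ : ∀ b i, σ b i * σ b i = 1)
    (hρ : ∀ i c b, ρ i = some b → b ≠ t c → A i c = 0)
    (hA : ∀ c (S : Finset (Fin k)), |∑ i ∈ S, σ (t c) i * A i c| ≤ 1) :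
    A.det ^ 2 ≤ 2 ^ (Finset.univ.filter fun i => ρ i = none).card := by
  classical
  induction k with
  | zero => simp
  | succ k ih =>
    by_cases hn : ∀ i, ρ i = none
    · have hcard : (Finset.univ.filter fun i => ρ i = none).card = k + 1 := by simp [hn]
      rw [hcard]
      refine det_sq_le_two_pow_of_sum_sq_le A fun c => ?_
      refine le_trans (Finset.sum_le_sum fun i _ => ?_)
        (sum_abs_le_two_of_abs_subset_sum_le_one _ (hA c))
      have h1 := hA c {i}
      rw [Finset.sum_singleton] at h1
      have h2 := abs_nonneg (A i c)
      rw [abs_mul, abs_eq_one_of_mul_self_eq_one (hσ _ _), one_mul] at h1 ⊢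
      rw [← sq_abs]
      nlinarith
    · obtain ⟨r, hr⟩ := not_forall.1 hn
      obtain ⟨b, hb⟩ := Option.ne_none_iff_exists'.1 hr
      by_cases hz : ∀ c, A r c = 0
      · rw [Matrix.det_eq_zero_of_row_eq_zero r hz]
        positivity
      obtain ⟨c, hc⟩ := not_forall.1 hz
      have htc : t c = b := by
        by_contra h
        exact hc (hρ r c b hb (Ne.symm h))
      have hsq : A r c * A r c = 1 := by
        have h1 := hA c {r}
        rw [Finset.sum_singleton, abs_mul, abs_eq_one_of_mul_self_eq_one (hσ _ _), one_mul] at h1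
        have h2 := abs_pos.2 hc
        rw [← abs_mul_abs_self, show |A r c| = 1 by omega, one_mul]
      obtain ⟨u, hu, hdet⟩ := det_eq_unit_mul_det_schur A r c hsq
      rw [hdet, mul_pow, pow_two u, hu, one_mul]
      refine (ih _ (fun i => ρ (r.succAbove i)) (fun j => t (c.succAbove j))
        (fun b i => σ b (r.succAbove i)) (fun b i => hσ _ _) ?_ ?_).trans ?_
      · intro i j b' hi hj
        rw [Matrix.of_apply, hρ _ _ b' hi hj, zero_sub, neg_eq_zero]
        by_cases h : t (c.succAbove j) = b
        · rw [hρ _ c b' hi (by rw [htc, ← h]; exact hj), zero_mul, zero_mul]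
        · rw [hρ r _ b hb (Ne.symm h), mul_zero]
      · intro j S
        have hmap : ∀ f : Fin (k + 1) → ℤ,
            ∑ i ∈ S, f (r.succAbove i) = ∑ i ∈ S.map r.succAboveEmb, f i := by
          intro f
          simp
        have hr' : r ∉ S.map r.succAboveEmb := by simp [Fin.succAbove_ne]
        have h1 := hA (c.succAbove j) (S.map r.succAboveEmb)
        have h2 := hA (c.succAbove j) (insert r (S.map r.succAboveEmb))
        have h3 := hA c (S.map r.succAboveEmb)
        have h4 := hA c (insert r (S.map r.succAboveEmb))
        rw [Finset.sum_insert hr'] at h2 h4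
        rw [← hmap] at h1 h2 h3 h4
        simp only [Matrix.of_apply]
        by_cases h : t (c.succAbove j) = b
        · rw [h] at h1 h2 ⊢
          rw [htc] at h3 h4
          have hexp : ∑ i ∈ S, σ b (r.succAbove i) * (A (r.succAbove i) (c.succAbove j)
                - A (r.succAbove i) c * A r c * A r (c.succAbove j))
              = ∑ i ∈ S, σ b (r.succAbove i) * A (r.succAbove i) (c.succAbove j)
                - (∑ i ∈ S, σ b (r.succAbove i) * A (r.succAbove i) c)
                  * A r c * A r (c.succAbove j) := by
            rw [Finset.sum_mul, Finset.sum_mul, ← Finset.sum_sub_distrib]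
            exact Finset.sum_congr rfl fun i _ => by ring
          rw [hexp]
          generalize ∑ i ∈ S, σ b (r.succAbove i) * A (r.succAbove i) (c.succAbove j) = X at *
          generalize ∑ i ∈ S, σ b (r.succAbove i) * A (r.succAbove i) c = Y at *
          have hY : Y = -1 ∨ Y = 0 ∨ Y = 1 := by rw [abs_le] at h3; omega
          rcases mul_self_eq_one_iff.1 (hσ b r) with hs | hs <;>
          rcases mul_self_eq_one_iff.1 hsq with ha | ha <;>
          rw [hs] at h2 h4 <;> rw [ha] at h4 ⊢ <;> rw [abs_le] at * <;>
          rcases hY with rfl | rfl | rfl <;> constructor <;> omega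
        · simpa [hρ r _ b hb (Ne.symm h)] using h1
      · refine pow_le_pow_right₀ (by norm_num) ?_
        refine Finset.card_le_card_of_injOn r.succAbove ?_ (Fin.succAbove_right_injective.injOn)
        intro i hi
        simpa using hi

theorem incK_eq_sub {n : ℕ} (v : Fin n) (e : CompEdge n) :
    incK n v e = (if v = e.1.1 then 1 else 0) - (if v = e.1.2 then 1 else 0) := by
  have := e.2.ne
  unfold incK
  split_ifs <;> simp_all

theorem abs_sum_incK_le_one {n : ℕ} (e : CompEdge n) (T : Finset (Fin n)) :
    |∑ v ∈ T, incK n v e| ≤ 1 := by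
  simp only [incK_eq_sub, Finset.sum_sub_distrib, Finset.sum_ite_eq']
  split_ifs <;> simp

theorem sum_incK {n : ℕ} (e : CompEdge n) : ∑ v, incK n v e = 0 := by
  simp [incK_eq_sub, Finset.sum_sub_distrib]

/-- The matrix `M_B ⊗ D(K_n)`. -/
abbrev bishopKron (n : ℕ) : Matrix (Fin 2 × Fin n) (Fin 2 × CompEdge n) ℤ :=
  (!![1, 1; 1, -1] : Matrix (Fin 2) (Fin 2) ℤ) ⊗ₖ incK n

theorem le_of_det_submatrix_bishopKron_ne_zero {n k : ℕ} (hn : 0 < n)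
    {f : Fin k → Fin 2 × Fin n} (hf : Function.Injective f) (g : Fin k → Fin 2 × CompEdge n)
    (hd : ((bishopKron n).submatrix f g).det ≠ 0) : k ≤ 2 * (n - 1) := by
  have hmiss : ∀ a, ∃ v, (a, v) ∉ Set.range f := by
    intro a
    by_contra! h
    choose p hp using h
    refine hd (Matrix.exists_vecMul_eq_zero_iff.1
      ⟨fun i => if (f i).1 = a then 1 else 0, fun h0 => ?_, ?_⟩)
    · simpa [hp] using congrFun h0 (p ⟨0, hn⟩)
    · ext c
      simp only [Matrix.vecMul, dotProduct, ite_mul, one_mul, zero_mul, Pi.zero_apply]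
      rw [← Finset.sum_filter]
      have : ∑ i with (f i).1 = a, ((bishopKron n).submatrix f g) i c
          = ∑ v, (!![1, 1; 1, -1] : Matrix (Fin 2) (Fin 2) ℤ) a (g c).1 * incK n v (g c).2 := by
        refine Finset.sum_nbij' (fun i => (f i).2) p (by simp) (by simp [hp]) ?_ (by simp [hp]) ?_
        · intro i hi
          apply hf
          rw [hp]
          simp only [Finset.mem_filter_univ] at hi
          rw [← hi]
        · intro i hi
          simp only [Finset.mem_filter_univ] at hi
          simp [Matrix.kroneckerMap_apply, hi]
      rw [this, ← Finset.mul_sum, sum_incK, mul_zero]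
  obtain ⟨v, hv⟩ := hmiss 0
  obtain ⟨w, hw⟩ := hmiss 1
  have hsub : Finset.univ.image f ⊆ (Finset.univ \ {(0, v), (1, w)}) := by
    intro x hx
    obtain ⟨i, -, rfl⟩ := Finset.mem_image.1 hx
    simp only [Finset.mem_sdiff, Finset.mem_univ, true_and, Finset.mem_insert,
      Finset.mem_singleton, not_or]
    exact ⟨fun h => hv ⟨i, h⟩, fun h => hw ⟨i, h⟩⟩
  have hcard := Finset.card_le_card hsub
  rw [Finset.card_image_of_injective _ hf, Finset.card_sdiff_of_subset (Finset.subset_univ _),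
    Finset.card_pair (by simp)] at hcard
  simp at hcard
  omega

/-- For an injective selection of rows of a matrix indexed by `Fin 2 × V`, there is an involution of
the selection pairing two rows exactly when they differ in the first coordinate only. -/
theorem exists_pairing {k : ℕ} {V : Type*} (f : Fin k → Fin 2 × V) (hf : Function.Injective f) :
    ∃ τ : Fin k → Fin k, (∀ i, τ (τ i) = i) ∧ (∀ i, τ i ≠ i → f (τ i) = ((f i).1 + 1, (f i).2)) ∧
      ∀ i j, i ≠ j → (f i).2 = (f j).2 → τ i = j := by
  classical
  have hex : ∀ i, ∃ j, (f j = ((f i).1 + 1, (f i).2)) ∨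
      (j = i ∧ ∀ l, f l ≠ ((f i).1 + 1, (f i).2)) := by
    intro i
    by_cases h : ∃ j, f j = ((f i).1 + 1, (f i).2)
    · exact h.imp fun _ => Or.inl
    · exact ⟨i, Or.inr ⟨rfl, not_exists.1 h⟩⟩
  have h11 : ∀ a : Fin 2, a + 1 + 1 = a := by decide
  have hne : ∀ a b : Fin 2, a ≠ b → b = a + 1 := by decide
  choose τ hτ using hex
  have key : ∀ i j, f j = ((f i).1 + 1, (f i).2) → τ i = j := by
    intro i j hij
    rcases hτ i with h | ⟨-, h⟩
    · exact hf (h.trans hij.symm)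
    · exact absurd hij (h j)
  refine ⟨τ, fun i => ?_, fun i hi => ?_, fun i j hij h => ?_⟩
  · rcases hτ i with h | ⟨h, -⟩
    · apply key
      rw [h, h11]
    · rw [h, h]
  · rcases hτ i with h | ⟨h, -⟩
    · exact h
    · exact absurd h hi
  · apply key
    refine Prod.ext (hne _ _ fun h1 => hij (hf (Prod.ext h1 h))) h.symm

theorem natAbs_det_submatrix_bishopKron_dvd {n k : ℕ} (hn : 0 < n)
    (f : Fin k → Fin 2 × Fin n) (g : Fin k → Fin 2 × CompEdge n)
    (hd : ((bishopKron n).submatrix f g).det ≠ 0) :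
    ((bishopKron n).submatrix f g).det.natAbs ∣ 2 ^ (n - 1) := by
  have hf : Function.Injective f := by
    intro i j hij
    by_contra hne
    exact hd (Matrix.det_zero_of_row_eq hne (by ext c; simp [hij]))
  have hk := le_of_det_submatrix_bishopKron_ne_zero hn hf g hd
  obtain ⟨τ, hττ, hτ, hpair⟩ := exists_pairing f hf
  let H : Matrix (Fin 2) (Fin 2) ℤ := !![1, 1; 1, -1]
  set N := (bishopKron n).submatrix f g
  have hNapp : ∀ i c, N i c = H (f i).1 (g c).1 * incK n (f i).2 (g c).2 := fun _ _ => rfl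
  let q : Fin k → ℤ := fun i => if τ i = i then 0 else H (f i).1 1
  let P : Matrix (Fin k) (Fin k) ℤ :=
    Matrix.of fun i j => (if i = j then q i else 0) + (if τ i = j then 1 else 0)
  let d : Fin k → ℤ := fun i => if τ i = i then 1 else 2
  let N' : Matrix (Fin k) (Fin k) ℤ := Matrix.of fun i c =>
    if τ i = i then N i c else if (f i).1 = (g c).1 then incK n (f i).2 (g c).2 else 0
  have hPmul : ∀ (X : Matrix (Fin k) (Fin k) ℤ) i c, (P * X) i c = q i * X i c + X (τ i) c := by
    intro X i c
    simp [Matrix.mul_apply, P, add_mul, Finset.sum_add_distrib]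
  have hH : ∀ a : Fin 2, H a 1 * H a 1 = 1 ∧ H (a + 1) 1 = -H a 1 := by
    simp only [H]; decide
  have hH2 : ∀ a b : Fin 2, H a b * H a b = 1 := by
    simp only [H]; decide
  have hH3 : ∀ a b : Fin 2, H a 1 * H a b + H (a + 1) b = if a = b then 2 else 0 := by
    simp only [H]; decide
  have hPP : P * P = Matrix.diagonal d := by
    ext i j
    rw [hPmul]
    simp only [P, Matrix.of_apply, hττ, Matrix.diagonal_apply, d, q]
    by_cases h : τ i = i
    · simp [h]
    · have h' : i ≠ τ i := Ne.symm h
      simp only [h, h', if_false, hτ i h, (hH _).2]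
      by_cases hij : i = j
      · subst hij
        simp [h, (hH _).1]
      · by_cases hj : τ i = j <;> simp [hij, hj]
  have hPN : P * N = Matrix.diagonal d * N' := by
    ext i c
    rw [hPmul, Matrix.diagonal_mul]
    simp only [N', d, q, Matrix.of_apply]
    by_cases h : τ i = i
    · simp [h]
    · simp only [h, if_false, hNapp, hτ i h]
      rw [← mul_assoc, ← add_mul, hH3]
      split_ifs <;> simp
  set s := (Finset.univ.filter fun i => τ i = i).card with hs
  set p := (Finset.univ.filter fun i => ¬ τ i = i).card with hp
  have hsp : s + p = k := by
    rw [hs, hp, Finset.card_filter_add_card_filter_not, Finset.card_univ, Fintype.card_fin]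
  have hdd : (Matrix.diagonal d).det = 2 ^ p := by
    rw [Matrix.det_diagonal, Finset.prod_ite]
    simp [hp]
  have hdP : P.det * P.det = 2 ^ p := by rw [← Matrix.det_mul, hPP, hdd]
  have hdN : P.det * N.det = 2 ^ p * N'.det := by rw [← Matrix.det_mul, hPN, Matrix.det_mul, hdd]
  let σ : Fin 2 → Fin k → ℤ := fun b i => if τ i = i then H (f i).1 b else 1
  have hσ : ∀ b i, σ b i * σ b i = 1 := by
    intro b i
    simp only [σ]
    split_ifs
    · exact hH2 _ _
    · rfl
  have hsub : ∀ c (S : Finset (Fin k)), |∑ i ∈ S, σ (g c).1 i * N' i c| ≤ 1 := by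
    intro c S
    have e : ∀ i, σ (g c).1 i * N' i c =
        if τ i = i ∨ (f i).1 = (g c).1 then incK n (f i).2 (g c).2 else 0 := by
      intro i
      simp only [σ, N', Matrix.of_apply]
      by_cases h : τ i = i
      · simp only [h, if_true, true_or, hNapp]
        rw [← mul_assoc, hH2, one_mul]
      · simp [h]
    simp only [e]
    rw [← Finset.sum_filter]
    have hinj : Set.InjOn (fun i => (f i).2)
        (S.filter fun i => τ i = i ∨ (f i).1 = (g c).1 : Finset (Fin k)) := by
      intro i hi j hj hij
      simp only [Finset.coe_filter, Set.mem_ofPred_eq] at hi hj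
      by_contra hne
      have h1 : τ i ≠ i := by rw [hpair i j hne hij]; exact Ne.symm hne
      have h2 : τ j ≠ j := by rw [hpair j i (Ne.symm hne) hij.symm]; exact hne
      exact hne (hf (Prod.ext ((hi.2.resolve_left h1).trans (hj.2.resolve_left h2).symm) hij))
    rw [← Finset.sum_image (f := fun v => incK n v (g c).2) hinj]
    exact abs_sum_incK_le_one _ _
  have hle : N'.det ^ 2 ≤ 2 ^ s := by
    have := det_sq_le_two_pow_card_none N' (fun i => if τ i = i then none else some (f i).1)
      (fun c => (g c).1) σ hσ (by
        intro i c b hi hb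
        by_cases h : τ i = i
        · simp [h] at hi
        · simp only [h, if_false, Option.some.injEq] at hi
          subst hi
          simp [N', h, hb]) hsub
    simpa [hs] using this
  have hN'0 : N'.det ≠ 0 := by
    intro h0
    rw [h0, mul_zero] at hdN
    rcases mul_eq_zero.1 hdN with h | h
    · rw [h] at hdP
      exact absurd hdP.symm (by positivity)
    · exact hd h
  obtain ⟨j, hj⟩ := exists_natAbs_det_eq_two_pow N' (fun c => by
    refine le_trans (le_of_eq (Finset.sum_congr rfl fun i _ => ?_))
      (sum_abs_le_two_of_abs_subset_sum_le_one _ (hsub c))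
    rw [abs_mul, abs_eq_one_of_mul_self_eq_one (hσ _ _), one_mul]) hN'0
  have hdvd : N.det.natAbs ∣ 2 ^ (p + j) := by
    refine ⟨P.det.natAbs, ?_⟩
    have := congrArg Int.natAbs hdN
    rw [Int.natAbs_mul, Int.natAbs_mul, hj, Int.natAbs_pow] at this
    rw [pow_add, mul_comm N.det.natAbs, this]
    rfl
  obtain ⟨m, -, hm⟩ := (Nat.dvd_prime_pow Nat.prime_two).1 hdvd
  have hNsq : N.det ^ 2 ≤ 2 ^ k := by
    have h1 : (2 : ℤ) ^ p * N.det ^ 2 = 2 ^ p * (2 ^ p * N'.det ^ 2) := by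
      calc _ = (P.det * N.det) ^ 2 := by rw [← hdP]; ring
        _ = _ := by rw [hdN]; ring
    have h2 := mul_left_cancel₀ (by positivity) h1
    have h5 : (2 : ℤ) ^ k = 2 ^ p * 2 ^ s := by rw [← pow_add, add_comm p, hsp]
    rw [h2, h5]
    exact mul_le_mul_of_nonneg_left hle (by positivity)
  rw [hm]
  refine pow_dvd_pow 2 ?_
  have h3 : (2 : ℤ) ^ (m * 2) ≤ 2 ^ k := by
    rw [← Int.natAbs_sq, hm] at hNsq
    rw [pow_mul]
    exact_mod_cast hNsq
  have h4 := (pow_le_pow_iff_right₀ (by norm_num : (1 : ℤ) < 2)).1 h3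
  omega

/-- The Kronecker product of the bishop matrix with the reduced incidence matrix of a path. -/
theorem exists_submatrix_bishopKron_natAbs_det (m : ℕ) :
    ∃ (f : Fin (2 * m) → Fin 2 × Fin (m + 1)) (g : Fin (2 * m) → Fin 2 × CompEdge (m + 1)),
      ((bishopKron (m + 1)).submatrix f g).det.natAbs = 2 ^ m := by
  let ed : Fin m → CompEdge (m + 1) := fun i => ⟨(i.castSucc, i.succ), Fin.castSucc_lt_succ⟩
  let T : Matrix (Fin m) (Fin m) ℤ := (incK (m + 1)).submatrix Fin.castSucc ed
  have hT : T.det = 1 := by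
    rw [Matrix.det_of_isLowerTriangular]
    · exact Finset.prod_eq_one fun i _ => if_pos rfl
    · intro i j hij
      have hij' : i.castSucc < j.castSucc := hij
      exact (if_neg hij'.ne).trans (if_neg (hij'.trans Fin.castSucc_lt_succ).ne)
  let e : Fin (2 * m) ≃ Fin 2 × Fin m := finProdFinEquiv.symm
  refine ⟨Prod.map id Fin.castSucc ∘ e, Prod.map id ed ∘ e, ?_⟩
  have : (bishopKron (m + 1)).submatrix (Prod.map id Fin.castSucc ∘ e) (Prod.map id ed ∘ e)
      = ((!![1, 1; 1, -1] : Matrix (Fin 2) (Fin 2) ℤ) ⊗ₖ T).submatrix e e := rfl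
  rw [this, Matrix.det_submatrix_equiv_self, Matrix.det_kronecker, hT, Matrix.det_fin_two_of,
    one_pow, mul_one, Int.natAbs_pow, Fintype.card_fin]
  rfl

/-- for the bishop matrix `M_B = ((1,1),(1,-1))` and `n ≥ 2`,
`lcmd(M_B ⊗ D(K_n)) = 2^(n-1)`. -/
theorem lcmd_bishop (n : ℕ) (hn : 2 ≤ n) :
    lcmd ((!![1, 1; 1, -1] : Matrix (Fin 2) (Fin 2) ℤ) ⊗ₖ incK n) = 2 ^ (n - 1) := by
  apply Nat.dvd_antisymm
  · refine Finset.lcm_dvd fun x hx => ?_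
    obtain ⟨hx0, hx⟩ := Finset.mem_erase.1 hx
    obtain ⟨y, -, rfl⟩ := Finset.mem_image.1 hx
    exact natAbs_det_submatrix_bishopKron_dvd (by omega) y.2.1 y.2.2 (Int.natAbs_ne_zero.1 hx0)
  · obtain ⟨m, rfl⟩ : ∃ m, n = m + 1 := ⟨n - 1, by omega⟩
    obtain ⟨f, g, hfg⟩ := exists_submatrix_bishopKron_natAbs_det m
    refine Finset.dvd_lcm (f := id) (Finset.mem_erase.2 ⟨by positivity, Finset.mem_image.2
      ⟨⟨⟨2 * m, ?_⟩, f, g⟩, Finset.mem_univ _, hfg⟩⟩)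
    simp only [Fintype.card_prod, Fintype.card_fin]
    omega
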